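/- Fix integers N and M with 1 ≤ N < M. For an integrable function f on (0,∞) and z ∈ ℂ∖[0,∞), let C(f)(z) = (1/(2πi))·∫₀^∞ f(s)/(s−z) ds denote the Cauchy transform. Set κ_{N−1} = −2πi/h_{N−1,0} and define, for z ∈ ℂ∖[0,∞), the 2×2 matrix Ẑ(z) with rows (L_N(z), C(L_N·w₀)(z)) and (κ_{N−1}·L_{N−1}(z), κ_{N−1}·C(L_{N−1}·w₀)(z)). Let K₂(x,x) = w₀(x)·(L_N′(x)·L_{N−1}(x) − L_N(x)·L_{N−1}′(x))/h_{N−1,0} be the diagonal of the Christoffel–Darboux kernel of the monic orthogonal polynomials for w₀. Then for every t ∈ ℂ∖[0,∞), the matrix Ẑ(t) is invertible and ∫₀^∞ K₂(x,x)/(t−x) dx = (1/2)·tr(Ẑ(t)^{−1}·Ẑ′(t)·σ₃), where σ₃ = diag(1,−1) and Ẑ′ is the entrywise complex derivative. -/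

import Mathlib

open MeasureTheory Polynomial Set

noncomputable section

/-- The weight `w(x) = e^{−Mx/2}·x^{(M−N−1)/2}·(t−x)^{−1/2}` on `(0,∞)`,
using the principal branch of the complex power. -/
def wC (M N : ℕ) (t : ℂ) (x : ℝ) : ℂ :=
  Complex.exp (-(M : ℂ) * x / 2) * (x : ℂ) ^ (((((M : ℝ) - N - 1) / 2 : ℝ)) : ℂ) *
    (t - x) ^ (-(1 / 2) : ℂ)

/-- The Laguerre weight `w₀(x) = x^{M−N}·e^{−Mx}`. -/
def w0R (M N : ℕ) (x : ℝ) : ℝ := x ^ (M - N) * Real.exp (-(M : ℝ) * x)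

/-- The skew product `⟨f,g⟩₁ = ∫₀^∞∫₀^∞ (1/2)·sgn(x−y)·f(x)·g(y)·w(x)·w(y) dy dx`. -/
def skew1 (M N : ℕ) (t : ℂ) (f g : Polynomial ℂ) : ℂ :=
  ∫ x in Ioi (0 : ℝ), ∫ y in Ioi (0 : ℝ),
    ((Real.sign (x - y) : ℝ) : ℂ) / 2 * f.eval (x : ℂ) * g.eval (y : ℂ) *
      wC M N t x * wC M N t y

/-- The inner product `⟨f,g⟩₂ = ∫₀^∞ f(x)·g(x)·w₀(x) dx`. -/
def inner2C (M N : ℕ) (f g : Polynomial ℂ) : ℂ :=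
  ∫ x in Ioi (0 : ℝ), f.eval (x : ℂ) * g.eval (x : ℂ) * (w0R M N x : ℂ)

/-- `IsLag M N L` says that `L n` is the monic degree-`n` orthogonal polynomial for the
weight `w₀` (the rescaled Laguerre polynomial). -/
def IsLag (M N : ℕ) (L : ℕ → Polynomial ℂ) : Prop :=
  ∀ n, (L n).Monic ∧ (L n).natDegree = n ∧
    ∀ j, j < n → inner2C M N (L n) (Polynomial.X ^ j) = 0

/-- The operator `T(q)(x) = x(t−x)q′(x) +
[(t−2x) − (M/2)x(t−x) + ((M−N−1)/2)(t−x) + x/2]·q(x)`,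
i.e. formally `T(q) = (d/dx)(q·x·(t−x)·w)/w`. -/
def Tq (M N : ℕ) (t : ℂ) (q : Polynomial ℂ) : Polynomial ℂ :=
  Polynomial.X * (Polynomial.C t - Polynomial.X) * Polynomial.derivative q +
    ((Polynomial.C t - 2 * Polynomial.X)
        - Polynomial.C ((M : ℂ) / 2) * (Polynomial.X * (Polynomial.C t - Polynomial.X))
        + Polynomial.C (((M : ℂ) - N - 1) / 2) * (Polynomial.C t - Polynomial.X)
        + Polynomial.C (1 / 2) * Polynomial.X) * q

/-- `ε(f)(x) = ∫₀^∞ (1/2)·sgn(x−y)·f(y) dy`. -/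
def epsC (f : ℝ → ℂ) (x : ℝ) : ℂ :=
  ∫ y in Ioi (0 : ℝ), ((Real.sign (x - y) : ℝ) : ℂ) / 2 * f y

/-- The squared norm `h_{n,0} = ∫₀^∞ L_n(x)²·w₀(x) dx`. -/
def hC (M N : ℕ) (L : ℕ → Polynomial ℂ) (n : ℕ) : ℂ :=
  ∫ x in Ioi (0 : ℝ), (L n).eval (x : ℂ) ^ 2 * (w0R M N x : ℂ)

end

theorem continuous_w0R (M N : ℕ) : Continuous (w0R M N) := by
  unfold w0R
  fun_prop

theorem integrableOn_pow_mul_exp_neg_mul (k : ℕ) {b : ℝ} (hb : 0 < b) :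
    IntegrableOn (fun x : ℝ => x ^ k * Real.exp (-b * x)) (Ioi 0) := by
  have h := integrableOn_rpow_mul_exp_neg_mul_rpow (p := 1) (s := k) (b := b)
    (by linarith [k.cast_nonneg (α := ℝ)]) one_pos hb
  simpa only [Real.rpow_natCast, Real.rpow_one] using h

/-- Polynomials are integrable against the Laguerre weight. -/
theorem integrableOn_eval_mul_w0R {M : ℕ} (hM : 0 < M) (N : ℕ) (p : ℂ[X]) :
    IntegrableOn (fun x : ℝ => p.eval (x : ℂ) * (w0R M N x : ℂ)) (Ioi 0) := by
  induction p using Polynomial.induction_on' with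
  | add p q hp hq =>
    simp only [eval_add, add_mul]
    exact hp.add hq
  | monomial k a =>
    have h := ((integrableOn_pow_mul_exp_neg_mul (k + (M - N))
      (Nat.cast_pos.mpr hM : (0 : ℝ) < M)).ofReal (𝕜 := ℂ)).const_mul a
    refine h.congr (ae_of_all _ fun x => ?_)
    change a * ((x ^ (k + (M - N)) * Real.exp (-M * x) : ℝ) : ℂ) = _
    simp only [eval_monomial, w0R, pow_add, Complex.ofReal_mul, Complex.ofReal_pow]
    ring

theorem integrableOn_eval_mul_eval_mul_w0R {M : ℕ} (hM : 0 < M) (N : ℕ) (p q : ℂ[X]) :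
    IntegrableOn (fun x : ℝ => p.eval (x : ℂ) * q.eval (x : ℂ) * (w0R M N x : ℂ)) (Ioi 0) := by
  simpa only [eval_mul] using integrableOn_eval_mul_w0R hM N (p * q)

theorem inner2C_add_right {M : ℕ} (hM : 0 < M) (N : ℕ) (f p q : ℂ[X]) :
    inner2C M N f (p + q) = inner2C M N f p + inner2C M N f q := by
  unfold inner2C
  rw [← integral_add (integrableOn_eval_mul_eval_mul_w0R hM N f p)
    (integrableOn_eval_mul_eval_mul_w0R hM N f q)]
  simp only [eval_add, mul_add, add_mul]

theorem inner2C_C_mul_right (M N : ℕ) (f p : ℂ[X]) (a : ℂ) :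
    inner2C M N f (C a * p) = a * inner2C M N f p := by
  unfold inner2C
  rw [← integral_const_mul]
  simp only [eval_mul, eval_C]
  congr 1 with x
  ring

theorem inner2C_sum_right {M : ℕ} (hM : 0 < M) (N : ℕ) (f : ℂ[X]) {ι : Type*} (s : Finset ι)
    (p : ι → ℂ[X]) : inner2C M N f (∑ i ∈ s, p i) = ∑ i ∈ s, inner2C M N f (p i) := by
  classical
  induction s using Finset.induction_on with
  | empty => simp [inner2C]
  | insert i s hi ih => rw [Finset.sum_insert hi, Finset.sum_insert hi, inner2C_add_right hM, ih]

section Orthogonality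

variable {M N : ℕ} {L : ℕ → ℂ[X]}

theorem IsLag.degree_eq (hL : IsLag M N L) (n : ℕ) : (L n).degree = n := by
  rw [degree_eq_natDegree (hL n).1.ne_zero, (hL n).2.1]

theorem IsLag.inner2C_eq_zero (hL : IsLag M N L) (hM : 0 < M) {n : ℕ} {q : ℂ[X]}
    (hq : q.degree < n) : inner2C M N (L n) q = 0 := by
  rw [as_sum_range_C_mul_X_pow q, inner2C_sum_right hM]
  refine Finset.sum_eq_zero fun i _ => ?_
  rw [inner2C_C_mul_right]
  rcases lt_or_ge i n with hi | hi
  · rw [(hL n).2.2 i hi, mul_zero]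
  · rw [coeff_eq_zero_of_degree_lt (hq.trans_le (by exact_mod_cast hi)), zero_mul]

theorem IsLag.inner2C_eq_hC (hL : IsLag M N L) (hM : 0 < M) {n : ℕ} {q : ℂ[X]}
    (hq : q.Monic) (hqn : q.natDegree = n) : inner2C M N (L n) q = hC M N L n := by
  have hdeg : q.degree = n := by rw [degree_eq_natDegree hq.ne_zero, hqn]
  have hlt : (q - L n).degree < n := by
    rw [← hdeg]
    exact degree_sub_lt_left (hdeg.trans (hL.degree_eq n).symm) hq.ne_zero
      (hq.leadingCoeff.trans (hL n).1.leadingCoeff.symm)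
  have h := inner2C_add_right hM N (L n) (L n) (q - L n)
  rw [add_sub_cancel, hL.inner2C_eq_zero hM hlt, add_zero] at h
  rw [h]
  simp only [inner2C, hC, sq]

theorem Polynomial.eval_map_starRingEnd_ofReal (p : ℂ[X]) (x : ℝ) :
    (p.map (starRingEnd ℂ)).eval (x : ℂ) = starRingEnd ℂ (p.eval (x : ℂ)) := by
  rw [← Complex.conj_ofReal x, eval_map, eval₂_hom, Complex.conj_ofReal]

theorem Polynomial.finite_setOf_eval_ofReal_eq_zero {p : ℂ[X]} (hp : p ≠ 0) :
    {x : ℝ | p.eval (x : ℂ) = 0}.Finite :=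
  (finite_setOfPred_isRoot hp).preimage Complex.ofReal_injective.injOn

theorem IsLag.hC_ne_zero (hL : IsLag M N L) (hM : 0 < M) (n : ℕ) : hC M N L n ≠ 0 := by
  have hmonic : ((L n).map (starRingEnd ℂ)).Monic := (hL n).1.map _
  have hprod : ∀ x : ℝ, (L n).eval (x : ℂ) * ((L n).map (starRingEnd ℂ)).eval (x : ℂ) *
      (w0R M N x : ℂ) = ((‖(L n).eval (x : ℂ)‖ ^ 2 * w0R M N x : ℝ) : ℂ) := fun x => by
    rw [eval_map_starRingEnd_ofReal, Complex.mul_conj']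
    push_cast
    rfl
  have hint := integrableOn_eval_mul_eval_mul_w0R hM N (L n) ((L n).map (starRingEnd ℂ))
  rw [← hL.inner2C_eq_hC hM hmonic (by rw [natDegree_map, (hL n).2.1]), inner2C]
  simp only [hprod] at hint ⊢
  rw [integral_complex_ofReal, Complex.ofReal_ne_zero]
  refine ne_of_gt ((setIntegral_pos_iff_support_of_nonneg_ae ?_ ?_).mpr ?_)
  · filter_upwards [ae_restrict_mem measurableSet_Ioi] with x (hx : 0 < x)
    simp only [w0R, Pi.zero_apply]
    positivity
  · exact hint.re
  · have hsub : Ioi (0 : ℝ) \ {x : ℝ | (L n).eval (x : ℂ) = 0} ⊆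
        Function.support (fun x : ℝ => ‖(L n).eval (x : ℂ)‖ ^ 2 * w0R M N x) ∩ Ioi 0 := by
      rintro x ⟨hx, hne⟩
      have hx' : 0 < x := hx
      refine ⟨?_, hx⟩
      have : 0 < ‖(L n).eval (x : ℂ)‖ := norm_pos_iff.mpr hne
      simp only [Function.mem_support, w0R]
      positivity
    refine lt_of_lt_of_le ?_ (measure_mono hsub)
    rw [measure_sdiff_null ((finite_setOf_eval_ofReal_eq_zero (hL n).1.ne_zero).measure_zero _)]
    simp

end Orthogonality

/-- The complement of `[0,∞)` in the complex plane. -/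
def offNonnegReal : Set ℂ := {z | ¬(z.im = 0 ∧ 0 ≤ z.re)}

theorem isOpen_offNonnegReal : IsOpen offNonnegReal :=
  ((isClosed_singleton.preimage Complex.continuous_im).inter
    (isClosed_Ici.preimage Complex.continuous_re)).isOpen_compl

/-- Near a point off `[0,∞)` the distance to `[0,∞)` is bounded below. -/
theorem exists_ball_le_norm_ofReal_sub {t : ℂ} (ht : t ∈ offNonnegReal) :
    ∃ δ > 0, ∀ z ∈ Metric.ball t δ, ∀ s : ℝ, 0 < s → δ ≤ ‖(s : ℂ) - z‖ := by
  obtain ⟨ε, hε, hsub⟩ := Metric.isOpen_iff.mp isOpen_offNonnegReal t ht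
  refine ⟨ε / 2, half_pos hε, fun z hz s hs => ?_⟩
  by_contra! hlt
  have hs' : (s : ℂ) ∈ Metric.ball t ε := by
    rw [Metric.mem_ball] at hz ⊢
    have := dist_triangle (s : ℂ) z t
    rw [dist_eq_norm (s : ℂ) z] at this
    linarith
  exact hsub hs' ⟨Complex.ofReal_im s, by simpa using hs.le⟩

theorem ofReal_sub_ne_zero {t : ℂ} (ht : t ∈ offNonnegReal) {s : ℝ} (hs : 0 < s) :
    (s : ℂ) - t ≠ 0 := fun h => ht (by
  rw [← sub_eq_zero.mp h]
  exact ⟨Complex.ofReal_im s, by simpa using hs.le⟩)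

/-- The integral `∫₀^∞ f(s)·w₀(s)/(s−z) ds`, that is, `2πi` times the Cauchy transform of
`f·w₀`. -/
noncomputable def cauchyW0 (M N : ℕ) (f : ℂ[X]) (z : ℂ) : ℂ :=
  ∫ s in Ioi (0 : ℝ), (f.eval (s : ℂ) * (w0R M N s : ℂ)) / ((s : ℂ) - z)

theorem integrableOn_eval_mul_w0R_div {M : ℕ} (hM : 0 < M) (N : ℕ) (f : ℂ[X]) {z : ℂ}
    (hz : z ∈ offNonnegReal) :
    IntegrableOn (fun s : ℝ => (f.eval (s : ℂ) * (w0R M N s : ℂ)) / ((s : ℂ) - z)) (Ioi 0) := by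
  obtain ⟨δ, hδ, hle⟩ := exists_ball_le_norm_ofReal_sub hz
  have hmeas : Measurable fun s : ℝ => ((s : ℂ) - z)⁻¹ := by fun_prop
  refine ((integrableOn_eval_mul_w0R hM N f).bdd_mul (c := δ⁻¹) hmeas.aestronglyMeasurable
    ?_).congr (ae_of_all _ fun s => (div_eq_inv_mul _ _).symm)
  filter_upwards [ae_restrict_mem measurableSet_Ioi] with s (hs : 0 < s)
  rw [norm_inv]
  exact inv_anti₀ hδ (hle z (Metric.mem_ball_self hδ) s hs)

theorem differentiableAt_cauchyW0 {M : ℕ} (hM : 0 < M) (N : ℕ) (f : ℂ[X]) {t : ℂ}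
    (ht : t ∈ offNonnegReal) : DifferentiableAt ℂ (cauchyW0 M N f) t := by
  obtain ⟨δ, hδ, hle⟩ := exists_ball_le_norm_ofReal_sub ht
  have hw := (continuous_w0R M N).measurable
  have hf : Measurable fun s : ℝ => f.eval (s : ℂ) :=
    (f.continuous.comp Complex.continuous_ofReal).measurable
  refine (hasDerivAt_integral_of_dominated_loc_of_deriv_le
    (F := fun z (s : ℝ) => (f.eval (s : ℂ) * (w0R M N s : ℂ)) / ((s : ℂ) - z))
    (F' := fun z (s : ℝ) => (f.eval (s : ℂ) * (w0R M N s : ℂ)) / ((s : ℂ) - z) ^ 2)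
    (bound := fun s : ℝ => ‖f.eval (s : ℂ) * (w0R M N s : ℂ)‖ / δ ^ 2)
    (Metric.ball_mem_nhds t hδ) (Filter.Eventually.of_forall fun z => ?_)
    (integrableOn_eval_mul_w0R_div hM N f ht) ?_ ?_ ?_ ?_).2.differentiableAt
  · exact Measurable.aestronglyMeasurable (by fun_prop)
  · exact Measurable.aestronglyMeasurable (by fun_prop)
  · filter_upwards [ae_restrict_mem measurableSet_Ioi] with s (hs : 0 < s) z hz
    rw [norm_div, norm_pow]
    gcongr
    exact hle z hz s hs
  · exact (integrableOn_eval_mul_w0R hM N f).norm.div_const _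
  · filter_upwards [ae_restrict_mem measurableSet_Ioi] with s (hs : 0 < s) z hz
    have hne : (s : ℂ) - z ≠ 0 := norm_pos_iff.mp (hδ.trans_le (hle z hz s hs))
    have h := (((hasDerivAt_id z).const_sub (s : ℂ)).inv hne).const_mul
      (f.eval (s : ℂ) * (w0R M N s : ℂ))
    simpa [div_eq_mul_inv] using h

/-- Extracting a polynomial factor from the Cauchy transform costs an inner product with the
divided difference. -/
theorem cauchyW0_mul {M : ℕ} (hM : 0 < M) (N : ℕ) (f p : ℂ[X]) {z : ℂ} (hz : z ∈ offNonnegReal) :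
    cauchyW0 M N (f * p) z =
      p.eval z * cauchyW0 M N f z + inner2C M N f (p /ₘ (X - C z)) := by
  unfold cauchyW0 inner2C
  rw [← integral_const_mul, ← integral_add ((integrableOn_eval_mul_w0R_div hM N f hz).const_mul _)
    (integrableOn_eval_mul_eval_mul_w0R hM N f _)]
  refine setIntegral_congr_fun measurableSet_Ioi fun s hs => ?_
  have hne := ofReal_sub_ne_zero hz hs
  have hp : p.eval (s : ℂ) = p.eval z + ((s : ℂ) - z) * (p /ₘ (X - C z)).eval (s : ℂ) := by
    conv_lhs => rw [← modByMonic_add_div p (X - C z), modByMonic_X_sub_C_eq_C_eval]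
    simp
  simp only [eval_mul, hp]
  field_simp

theorem degree_divByMonic_X_sub_C_lt {p : ℂ[X]} {n : ℕ} (hp : p.degree ≤ n) (z : ℂ) :
    (p /ₘ (X - C z)).degree < n := by
  rcases eq_or_ne p 0 with rfl | hp0
  · simp
  · exact (degree_divByMonic_lt p _ hp0 (by simp)).trans_le hp

section Laguerre

variable {M N : ℕ} {L : ℕ → ℂ[X]}

/-- The Cauchy transform of `L_n·p·w₀` factors when `p` has degree at most `n`. -/
theorem IsLag.cauchyW0_mul_of_degree_le (hL : IsLag M N L) (hM : 0 < M) {n : ℕ} {p : ℂ[X]}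
    (hp : p.degree ≤ n) {z : ℂ} (hz : z ∈ offNonnegReal) :
    cauchyW0 M N (L n * p) z = p.eval z * cauchyW0 M N (L n) z := by
  rw [cauchyW0_mul hM N _ _ hz, hL.inner2C_eq_zero hM (degree_divByMonic_X_sub_C_lt hp z),
    add_zero]

theorem IsLag.monic_divByMonic (hL : IsLag M N L) (n : ℕ) (z : ℂ) :
    (L (n + 1) /ₘ (X - C z)).Monic := by
  rw [Monic, leadingCoeff_divByMonic_of_monic (monic_X_sub_C z), (hL _).1.leadingCoeff]
  rw [hL.degree_eq, degree_X_sub_C]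
  exact_mod_cast Nat.le_add_left 1 n

/-- The Casoratian of `L_n` and its Cauchy transform is the squared norm. -/
theorem IsLag.casoratian (hL : IsLag M N L) (hM : 0 < M) (n : ℕ) {z : ℂ}
    (hz : z ∈ offNonnegReal) :
    (L n).eval z * cauchyW0 M N (L (n + 1)) z - (L (n + 1)).eval z * cauchyW0 M N (L n) z =
      hC M N L n := by
  have h₁ := hL.cauchyW0_mul_of_degree_le hM (n := n + 1) (p := L n)
    (by rw [hL.degree_eq]; exact_mod_cast n.le_succ) hz
  have h₂ := cauchyW0_mul hM N (L n) (L (n + 1)) hz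
  rw [hL.inner2C_eq_hC hM (hL.monic_divByMonic n z)
    (by rw [natDegree_divByMonic _ (monic_X_sub_C z), (hL _).2.1, natDegree_X_sub_C,
      Nat.add_sub_cancel]), mul_comm (L n)] at h₂
  linear_combination h₂ - h₁

theorem IsLag.degree_derivative_le (hL : IsLag M N L) {n k : ℕ} (h : n ≤ k + 1) :
    (derivative (L n)).degree ≤ k := by
  refine degree_le_of_natDegree_le ((natDegree_derivative_le _).trans ?_)
  rw [(hL n).2.1]
  lia

/-- The Cauchy transform of the diagonal Christoffel–Darboux kernel, up to normalization. -/
theorem IsLag.integral_wronskian_div (hL : IsLag M N L) (hM : 0 < M) (n : ℕ) {t : ℂ}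
    (ht : t ∈ offNonnegReal) :
    (∫ x in Ioi (0 : ℝ),
        ((w0R M N x : ℂ) *
            ((derivative (L (n + 1))).eval (x : ℂ) * (L n).eval (x : ℂ)
              - (L (n + 1)).eval (x : ℂ) * (derivative (L n)).eval (x : ℂ)) /
            hC M N L n) / (t - (x : ℂ))) =
      ((derivative (L n)).eval t * cauchyW0 M N (L (n + 1)) t
        - (derivative (L (n + 1))).eval t * cauchyW0 M N (L n) t) / hC M N L n := by
  rw [← hL.cauchyW0_mul_of_degree_le hM (hL.degree_derivative_le (by lia)) ht,
    ← hL.cauchyW0_mul_of_degree_le hM (hL.degree_derivative_le le_rfl) ht]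
  unfold cauchyW0
  rw [← integral_sub (integrableOn_eval_mul_w0R_div hM N _ ht)
    (integrableOn_eval_mul_w0R_div hM N _ ht), ← integral_div]
  refine setIntegral_congr_fun measurableSet_Ioi fun s hs => ?_
  simp only [eval_mul]
  rw [← neg_sub (s : ℂ) t, div_neg]
  ring

end Laguerre

/-- With `w₀` the Laguerre weight, `L_n` its monic orthogonal
polynomials, `h_{N−1,0}` the squared norm, `κ_{N−1} = −2πi/h_{N−1,0}`,
`C(f)(z) = (1/(2πi))∫₀^∞ f(s)/(s−z) ds` the Cauchy transform, and `Ẑ` the `2×2`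
matrix with rows `(L_N, C(L_N w₀))` and `κ_{N−1}·(L_{N−1}, C(L_{N−1} w₀))`, for every
`t ∈ ℂ∖[0,∞)` the matrix `Ẑ(t)` is invertible and
`∫₀^∞ K₂(x,x)/(t−x) dx = (1/2)·tr(Ẑ(t)⁻¹·Ẑ′(t)·σ₃)`, where
`K₂(x,x) = w₀(x)(L_N′(x)L_{N−1}(x) − L_N(x)L_{N−1}′(x))/h_{N−1,0}` and `σ₃ = diag(1,−1)`. -/
theorem stmt_19 (M N : ℕ) (hN : 1 ≤ N) (hNM : N < M)
    (L : ℕ → Polynomial ℂ) (hL : IsLag M N L)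
    (Zhat : ℂ → Matrix (Fin 2) (Fin 2) ℂ)
    (hZ : ∀ z : ℂ, Zhat z =
      !![(L N).eval z,
          (1 / (2 * (Real.pi : ℂ) * Complex.I)) *
            ∫ s in Ioi (0 : ℝ), ((L N).eval (s : ℂ) * (w0R M N s : ℂ)) / ((s : ℂ) - z);
          -(2 * (Real.pi : ℂ) * Complex.I) / hC M N L (N - 1) * (L (N - 1)).eval z,
          -(2 * (Real.pi : ℂ) * Complex.I) / hC M N L (N - 1) *
            ((1 / (2 * (Real.pi : ℂ) * Complex.I)) *
              ∫ s in Ioi (0 : ℝ),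
                ((L (N - 1)).eval (s : ℂ) * (w0R M N s : ℂ)) / ((s : ℂ) - z))])
    (t : ℂ) (ht : ¬(t.im = 0 ∧ 0 ≤ t.re)) :
    IsUnit (Zhat t) ∧
    (∫ x in Ioi (0 : ℝ),
        ((w0R M N x : ℂ) *
            ((Polynomial.derivative (L N)).eval (x : ℂ) * (L (N - 1)).eval (x : ℂ)
              - (L N).eval (x : ℂ) *
                  (Polynomial.derivative (L (N - 1))).eval (x : ℂ)) /
            hC M N L (N - 1)) / (t - (x : ℂ)))
      = (1 / 2) * Matrix.trace ((Zhat t)⁻¹ *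
          (Matrix.of fun i j : Fin 2 => deriv (fun z => Zhat z i j) t) *
          !![(1 : ℂ), 0; 0, -1]) := by
  obtain ⟨n, rfl⟩ : ∃ n, N = n + 1 := ⟨N - 1, by lia⟩
  have hM : 0 < M := by lia
  have ht' : t ∈ offNonnegReal := ht
  simp only [Nat.add_sub_cancel] at hZ ⊢
  have hh := hL.hC_ne_zero hM n
  have hc : 2 * (Real.pi : ℂ) * Complex.I ≠ 0 := Complex.two_pi_I_ne_zero
  set c : ℂ := 2 * (Real.pi : ℂ) * Complex.I
  set h := hC M (n + 1) L n with hdef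
  set P := L (n + 1) with hP
  set Q := L n with hQ
  change ∀ z, Zhat z = !![P.eval z, 1 / c * cauchyW0 M (n + 1) P z;
    -c / h * Q.eval z, -c / h * (1 / c * cauchyW0 M (n + 1) Q z)] at hZ
  have hcas : ∀ z ∈ offNonnegReal, Q.eval z * cauchyW0 M (n + 1) P z -
      P.eval z * cauchyW0 M (n + 1) Q z = h := fun z hz => hL.casoratian hM n hz
  have hdet : (Zhat t).det = 1 := by
    rw [hZ, Matrix.det_fin_two_of]
    field_simp
    linear_combination hcas t ht'
  refine ⟨(Matrix.isUnit_iff_isUnit_det _).mpr (by rw [hdet]; exact isUnit_one), ?_⟩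
  have hA := (differentiableAt_cauchyW0 hM (n + 1) P ht').hasDerivAt
  have hB := (differentiableAt_cauchyW0 hM (n + 1) Q ht').hasDerivAt
  have hconst : HasDerivAt (fun z => Q.eval z * cauchyW0 M (n + 1) P z -
      P.eval z * cauchyW0 M (n + 1) Q z) 0 t :=
    (hasDerivAt_const t h).congr_of_eventuallyEq
      (Filter.eventually_of_mem (isOpen_offNonnegReal.mem_nhds ht') hcas)
  have hrel := (((Q.hasDerivAt t).mul hA).sub ((P.hasDerivAt t).mul hB)).unique hconst
  rw [hL.integral_wronskian_div hM n ht', ← hP, ← hQ, ← hdef, Matrix.inv_def, hdet, Ring.inverse_one, one_smul]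
  have h₀₀ : deriv (fun z => Zhat z 0 0) t = P.derivative.eval t := by
    simp [hZ]
  have h₀₁ : deriv (fun z => Zhat z 0 1) t = 1 / c * deriv (cauchyW0 M (n + 1) P) t := by
    simp [hZ]
  have h₁₀ : deriv (fun z => Zhat z 1 0) t = -c / h * Q.derivative.eval t := by
    simp [hZ]
  have h₁₁ : deriv (fun z => Zhat z 1 1) t =
      -c / h * (1 / c * deriv (cauchyW0 M (n + 1) Q) t) := by
    simp [hZ]
  rw [hZ t, Matrix.adjugate_fin_two_of, Matrix.trace_fin_two]
  simp only [Matrix.mul_apply, Fin.sum_univ_two, Matrix.of_apply, h₀₀, h₀₁, h₁₀, h₁₁]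
  simp
  field_simp
  linear_combination hrel
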